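/- Lemma 2.1 (compactness of the embedding). Assume condition (V). Then for i=1,2, the embedding E_i ↪ L^r(V) is compact for every 2≤r≤∞: for any sequence {u_k}⊂E_i with sup_k ‖u_k‖_{E_i}<∞ there exist a subsequence (still denoted u_k) and u∈E_i such that u_k converges weakly to u in E_i, u_k(x)→u(x) for every x∈V, and ‖u_k−u‖_r→0 for every 2≤r≤∞ (including ‖u_k−u‖_∞→0). -/

import Mathlib

open Filter Topology

/-- A connected, locally finite weighted graph `G = (V, E)` with symmetric positive edge
weights `w` (vanishing off edges) and a vertex measure `mu` with positive lower bound
`mumin`. -/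
structure WeightedGraph (V : Type*) where
  G : SimpleGraph V
  connected : G.Connected
  locallyFinite : ∀ x : V, (G.neighborSet x).Finite
  w : V → V → ℝ
  w_symm : ∀ x y, w x y = w y x
  w_pos : ∀ x y, G.Adj x y → 0 < w x y
  w_eq_zero : ∀ x y, ¬ G.Adj x y → w x y = 0
  mu : V → ℝ
  mumin : ℝ
  mumin_pos : 0 < mumin
  mu_ge : ∀ x, mumin ≤ mu x

namespace WeightedGraph

variable {V : Type*} (S : WeightedGraph V)

/-- `∫_V φ dμ = Σ_{x ∈ V} φ(x) μ(x)`. -/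
noncomputable def integral (φ : V → ℝ) : ℝ := ∑' x, φ x * S.mu x

/-- The graph Laplacian `Δu(x) = (1/μ(x)) Σ_{y ∼ x} w_{xy} (u(y) - u(x))`. -/
noncomputable def lap (u : V → ℝ) (x : V) : ℝ :=
  (1 / S.mu x) * ∑' y, S.w x y * (u y - u x)

/-- `|∇u|²(x) = (1/(2μ(x))) Σ_{y ∼ x} w_{xy} (u(y) - u(x))²`. -/
noncomputable def gradSq (u : V → ℝ) (x : V) : ℝ :=
  (1 / (2 * S.mu x)) * ∑' y, S.w x y * (u y - u x) ^ 2

/-- `∇u·∇v(x) = (1/(2μ(x))) Σ_{y ∼ x} w_{xy} (u(y) - u(x))(v(y) - v(x))`. -/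
noncomputable def gradDot (u v : V → ℝ) (x : V) : ℝ :=
  (1 / (2 * S.mu x)) * ∑' y, S.w x y * (u y - u x) * (v y - v x)

/-- The `L^r` norm `‖u‖_r = (∫_V |u|^r dμ)^{1/r}` for `1 ≤ r < ∞`. -/
noncomputable def normLr (r : ℝ) (u : V → ℝ) : ℝ :=
  (S.integral fun x => |u x| ^ r) ^ (1 / r)

/-- The density `|Δu|² + a |∇u|² + V(x) u²` defining the norm of the space `E_i`. -/
noncomputable def energyDensity (a : ℝ) (Vp : V → ℝ) (u : V → ℝ) (x : V) : ℝ :=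
  (S.lap u x) ^ 2 + a * S.gradSq u x + Vp x * (u x) ^ 2

/-- Membership in the working space `E_i` (finiteness of the `E_i`-norm). -/
def memE (a : ℝ) (Vp : V → ℝ) (u : V → ℝ) : Prop :=
  Summable fun x => S.energyDensity a Vp u x * S.mu x

/-- The norm `‖u‖_{E_i} = (∫_V (|Δu|² + a_i |∇u|² + V_i(x)u²) dμ)^{1/2}`. -/
noncomputable def normE (a : ℝ) (Vp : V → ℝ) (u : V → ℝ) : ℝ :=
  Real.sqrt (S.integral (S.energyDensity a Vp u))

/-- The inner product `(u,v)_{E_i} = ∫_V (Δu Δv + a_i ∇u·∇v + V_i(x) u v) dμ`. -/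
noncomputable def innerE (a : ℝ) (Vp : V → ℝ) (u v : V → ℝ) : ℝ :=
  S.integral fun x => S.lap u x * S.lap v x + a * S.gradDot u v x + Vp x * u x * v x

/-- The energy functional `Φ` of the biharmonic–Kirchhoff system. -/
noncomputable def Phi (a₁ a₂ b₁ b₂ : ℝ) (V₁ V₂ : V → ℝ) (F : V → ℝ → ℝ → ℝ)
    (u v : V → ℝ) : ℝ :=
  (1/2) * S.integral (S.energyDensity a₁ V₁ u) + (1/2) * S.integral (S.energyDensity a₂ V₂ v)
    + (b₁/4) * (S.integral (S.gradSq u)) ^ 2 + (b₂/4) * (S.integral (S.gradSq v)) ^ 2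
    - S.integral fun x => F x (u x) (v x)

/-- The action `⟨Φ'(u,v), (φ₁,φ₂)⟩` of the derivative of `Φ`. -/
noncomputable def PhiDeriv (a₁ a₂ b₁ b₂ : ℝ) (V₁ V₂ : V → ℝ) (Fs Ft : V → ℝ → ℝ → ℝ)
    (u v φ₁ φ₂ : V → ℝ) : ℝ :=
  S.innerE a₁ V₁ u φ₁ + S.innerE a₂ V₂ v φ₂
    + b₁ * S.integral (S.gradSq u) * S.integral (S.gradDot u φ₁)
    + b₂ * S.integral (S.gradSq v) * S.integral (S.gradDot v φ₂)
    - S.integral (fun x => Fs x (u x) (v x) * φ₁ x)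
    - S.integral (fun x => Ft x (u x) (v x) * φ₂ x)

/-- `(u,v)` solves the biharmonic–Kirchhoff system (pointwise on `V`). -/
def IsSolution (a₁ a₂ b₁ b₂ : ℝ) (V₁ V₂ : V → ℝ) (Fs Ft : V → ℝ → ℝ → ℝ)
    (u v : V → ℝ) : Prop :=
  (∀ x, S.lap (S.lap u) x - (a₁ + b₁ * S.integral (S.gradSq u)) * S.lap u x + V₁ x * u x
      = Fs x (u x) (v x)) ∧
  (∀ x, S.lap (S.lap v) x - (a₂ + b₂ * S.integral (S.gradSq v)) * S.lap v x + V₂ x * v x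
      = Ft x (u x) (v x))

/-- Condition (V): `θᵢ = inf_V Vᵢ > 0` and `Vᵢ(x) → +∞` as `d(x,x₀) → ∞`. -/
def CondV (V₁ V₂ : V → ℝ) (θ₁ θ₂ : ℝ) : Prop :=
  IsGLB (Set.range V₁) θ₁ ∧ IsGLB (Set.range V₂) θ₂ ∧ 0 < θ₁ ∧ 0 < θ₂ ∧
    ∃ x₀ : V, ∀ M : ℝ, ∃ N : ℕ, ∀ x : V, N ≤ S.G.dist x₀ x → M ≤ V₁ x ∧ M ≤ V₂ x

/-- Condition (F₀). -/
def CondF0 (F : V → ℝ → ℝ → ℝ) : Prop :=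
  (∀ x, F x 0 0 = 0) ∧ ∀ x, ContDiff ℝ 1 (fun p : ℝ × ℝ => F x p.1 p.2)

/-- `Fs` and `Ft` are the partial derivatives of `F` in its last two arguments. -/
def IsPartialDerivs (F Fs Ft : V → ℝ → ℝ → ℝ) : Prop :=
  ∀ x s t, HasDerivAt (fun s' => F x s' t) (Fs x s t) s ∧
           HasDerivAt (fun t' => F x s t') (Ft x s t) t

/-- Condition (F₁). -/
def CondF1 (F Fs Ft : V → ℝ → ℝ → ℝ) (a : ℝ → ℝ) (b : V → ℝ) : Prop :=
  ContinuousOn a (Set.Ici 0) ∧ (∀ r : ℝ, 0 ≤ r → 0 ≤ a r) ∧ (∀ x, 0 < b x) ∧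
    Summable (fun x => b x * S.mu x) ∧
    ∀ x s t, |Fs x s t| ≤ a (Real.sqrt (s ^ 2 + t ^ 2)) * b x ∧
             |Ft x s t| ≤ a (Real.sqrt (s ^ 2 + t ^ 2)) * b x ∧
             |F x s t| ≤ a (Real.sqrt (s ^ 2 + t ^ 2)) * b x

/-- Condition (C₁): `lim_{r → 0⁺} a(r)/r² = h < ∞`. -/
def CondC1 (a : ℝ → ℝ) : Prop :=
  ∃ h : ℝ, Tendsto (fun r => a r / r ^ 2) (nhdsWithin 0 (Set.Ioi 0)) (nhds h)

/-- `γ_{∞,i} = (μ_min · inf_V V_i)^{-1/2}`. -/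
noncomputable def gammaInf (θ : ℝ) : ℝ := 1 / Real.sqrt (S.mumin * θ)

/-- Condition (C₂). -/
def CondC2 (a : ℝ → ℝ) (b : V → ℝ) (θ₁ θ₂ : ℝ) : Prop :=
  ∃ ρ : ℝ, 0 < ρ ∧
    0 < ρ ^ 2 / 4 - sSup (a '' Set.Icc 0 ((S.gammaInf θ₁ + S.gammaInf θ₂) * ρ)) * S.integral b

/-- Condition (F₂): `F(x,s,t)/|(s,t)|⁴ → +∞` as `|(s,t)| → ∞`, uniformly in `x`. -/
def CondF2 (F : V → ℝ → ℝ → ℝ) : Prop :=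
  ∀ M : ℝ, ∃ R : ℝ, ∀ x s t, R ≤ Real.sqrt (s ^ 2 + t ^ 2) → M * (s ^ 2 + t ^ 2) ^ 2 ≤ F x s t

/-- Condition (F₂)': `F(x,s,t)/|(s,t)|² → +∞` as `|(s,t)| → ∞`, uniformly in `x`. -/
def CondF2' (F : V → ℝ → ℝ → ℝ) : Prop :=
  ∀ M : ℝ, ∃ R : ℝ, ∀ x s t, R ≤ Real.sqrt (s ^ 2 + t ^ 2) → M * (s ^ 2 + t ^ 2) ≤ F x s t

/-- Condition (F₃): `F ≥ 0` outside the ball of radius `r₀`. -/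
def CondF3 (F : V → ℝ → ℝ → ℝ) (r₀ : ℝ) : Prop :=
  ∀ x s t, r₀ ≤ Real.sqrt (s ^ 2 + t ^ 2) → 0 ≤ F x s t

/-- `𝓕(x,s,t) = λ (s F_s + t F_t) - F` (with `λ = 1/4` resp. `1/2`). -/
noncomputable def curlyF (lam : ℝ) (F Fs Ft : V → ℝ → ℝ → ℝ) (x : V) (s t : ℝ) : ℝ :=
  lam * (s * Fs x s t + t * Ft x s t) - F x s t

/-- Condition (F₄) (with `λ = 1/4`); `k` is a real exponent and `^` is `Real.rpow`. -/
def CondF4 (F Fs Ft : V → ℝ → ℝ → ℝ) (r₀ : ℝ) : Prop :=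
  (∀ (x : V) (s t : ℝ), 0 ≤ curlyF (1/4) F Fs Ft x s t) ∧
  ∃ c : ℝ, 0 < c ∧ ∃ k : ℝ, 1 < k ∧ ∀ (x : V) (s t : ℝ), r₀ ≤ Real.sqrt (s ^ 2 + t ^ 2) →
    |F x s t| ^ k ≤ c * (s ^ 2 + t ^ 2) ^ k * curlyF (1/4) F Fs Ft x s t

/-- Condition (F₄)' (with `λ = 1/2`). -/
def CondF4' (F Fs Ft : V → ℝ → ℝ → ℝ) (r₀ : ℝ) : Prop :=
  (∀ (x : V) (s t : ℝ), 0 ≤ curlyF (1/2) F Fs Ft x s t) ∧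
  ∃ c : ℝ, 0 < c ∧ ∃ k : ℝ, 1 < k ∧ ∀ (x : V) (s t : ℝ), r₀ ≤ Real.sqrt (s ^ 2 + t ^ 2) →
    |F x s t| ^ k ≤ c * (s ^ 2 + t ^ 2) ^ k * curlyF (1/2) F Fs Ft x s t

/-- `γ_{2,i} = (inf_V V_i)^{-1/2}`. -/
noncomputable def gamma2 (θ : ℝ) : ℝ := 1 / Real.sqrt θ

/-- Condition (F₅) (`lb = 4`), resp. (F₅)' (`lb = 2`): there are `μ̄ > lb` and an admissible
`σ` with `μ̄ F ≤ s F_s + t F_t + σ (s² + t²)`. -/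
def CondF5 (lb : ℝ) (F Fs Ft : V → ℝ → ℝ → ℝ) (θ₁ θ₂ : ℝ) : Prop :=
  ∃ μb : ℝ, lb < μb ∧ ∃ σ : ℝ, 0 < σ ∧
    σ < (μb - 2) / (2 * max (gamma2 θ₁ ^ 2) (gamma2 θ₂ ^ 2)) ∧
    ∀ (x : V) (s t : ℝ), μb * F x s t ≤ s * Fs x s t + t * Ft x s t + σ * (s ^ 2 + t ^ 2)

/-- Condition (F₆): `F` is even in `(s,t)`. -/
def CondF6 (F : V → ℝ → ℝ → ℝ) : Prop :=
  ∀ (x : V) (s t : ℝ), F x (-s) (-t) = F x s t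

/-- A Cerami sequence for `Φ`: `Φ(uₙ,vₙ)` is bounded and
`(1 + ‖(uₙ,vₙ)‖)‖Φ'(uₙ,vₙ)‖_{E*} → 0`. -/
def CeramiSeq (a₁ a₂ b₁ b₂ : ℝ) (V₁ V₂ : V → ℝ) (F Fs Ft : V → ℝ → ℝ → ℝ)
    (u v : ℕ → V → ℝ) : Prop :=
  (∀ n, S.memE a₁ V₁ (u n) ∧ S.memE a₂ V₂ (v n)) ∧
  (∃ C : ℝ, ∀ n, |S.Phi a₁ a₂ b₁ b₂ V₁ V₂ F (u n) (v n)| ≤ C) ∧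
  ∃ ε : ℕ → ℝ, Tendsto ε atTop (nhds 0) ∧
    ∀ (n : ℕ) (φ₁ φ₂ : V → ℝ), S.memE a₁ V₁ φ₁ → S.memE a₂ V₂ φ₂ →
      S.normE a₁ V₁ φ₁ + S.normE a₂ V₂ φ₂ ≤ 1 →
      (1 + (S.normE a₁ V₁ (u n) + S.normE a₂ V₂ (v n))) *
        |S.PhiDeriv a₁ a₂ b₁ b₂ V₁ V₂ Fs Ft (u n) (v n) φ₁ φ₂| ≤ ε n

end WeightedGraph

open WeightedGraph

/-- Pointwise convergence together with uniformly small tails gives convergence of sums, and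
summability of the limit. -/
lemma tendsto_tsum_of_uniform_tail {X : Type*} {f : ℕ → X → ℝ} {g : X → ℝ}
    (hlim : ∀ x, Tendsto (fun k => f k x) atTop (𝓝 (g x)))
    (htail : ∀ ε : ℝ, 0 < ε → ∃ F : Finset X, ∀ k, ∀ T : Finset X, Disjoint T F →
      |∑ x ∈ T, f k x| ≤ ε) :
    Tendsto (fun k => ∑' x, f k x) atTop (𝓝 (∑' x, g x)) := by
  classical
  have htail' : ∀ ε : ℝ, 0 < ε → ∃ F : Finset X, ∀ T : Finset X, Disjoint T F →
      |∑ x ∈ T, g x| ≤ ε := by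
    intro ε hε
    obtain ⟨F, hF⟩ := htail ε hε
    refine ⟨F, fun T hT => ?_⟩
    exact le_of_tendsto (tendsto_finsetSum T fun x _ => hlim x).abs
      (Eventually.of_forall fun k => hF k T hT)
  have hsum : ∀ h : X → ℝ, (∀ ε : ℝ, 0 < ε → ∃ F : Finset X, ∀ T : Finset X, Disjoint T F →
      |∑ x ∈ T, h x| ≤ ε) → Summable h := by
    intro h hh
    refine summable_iff_vanishing_norm.2 fun ε hε => ?_
    obtain ⟨F, hF⟩ := hh (ε / 2) (half_pos hε)
    exact ⟨F, fun T hT => (hF T hT).trans_lt (half_lt_self hε)⟩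
  have hclose : ∀ (h : X → ℝ) (ε : ℝ) (F : Finset X), Summable h →
      (∀ T : Finset X, Disjoint T F → |∑ x ∈ T, h x| ≤ ε) →
      |∑' x, h x - ∑ x ∈ F, h x| ≤ ε := by
    intro h ε F hs hF
    have ht : Tendsto (fun T : Finset X => |∑ x ∈ T, h x - ∑ x ∈ F, h x|) atTop
        (𝓝 |∑' x, h x - ∑ x ∈ F, h x|) := (hs.hasSum.sub_const _).abs
    refine le_of_tendsto ht ((eventually_ge_atTop F).mono fun T hT => ?_)
    rw [← Finset.sum_sdiff hT, add_sub_cancel_right]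
    exact hF _ Finset.sdiff_disjoint
  rw [Metric.tendsto_atTop]
  intro ε hε
  obtain ⟨F, hF⟩ := htail (ε / 4) (by positivity)
  have hFg : ∀ T : Finset X, Disjoint T F → |∑ x ∈ T, g x| ≤ ε / 4 := fun T hT =>
    le_of_tendsto (tendsto_finsetSum T fun x _ => hlim x).abs
      (Eventually.of_forall fun k => hF k T hT)
  obtain ⟨N, hN⟩ := Metric.tendsto_atTop.1 (tendsto_finsetSum F fun x _ => hlim x)
    (ε / 4) (by positivity)
  refine ⟨N, fun k hk => ?_⟩
  have hfs : Summable (f k) := hsum _ fun δ hδ => by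
    obtain ⟨F', hF'⟩ := htail δ hδ
    exact ⟨F', hF' k⟩
  have h1 := abs_le.1 (hclose _ _ F hfs (hF k))
  have h2 := abs_le.1 (hclose _ _ F (hsum _ htail') hFg)
  have h3 := hN k hk
  rw [Real.dist_eq, abs_lt] at h3 ⊢
  constructor <;> linarith [h1.1, h1.2, h2.1, h2.2, h3.1, h3.2]

/-- Young's inequality with a parameter. -/
lemma abs_mul_le_weighted_sq {δ : ℝ} (hδ : 0 < δ) (p q : ℝ) :
    |p * q| ≤ δ * p ^ 2 + δ⁻¹ * q ^ 2 := by
  have h : δ * p ^ 2 + δ⁻¹ * q ^ 2 - 2 * |p * q| = δ * (|p| - δ⁻¹ * |q|) ^ 2 := by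
    rw [abs_mul, ← sq_abs p, ← sq_abs q]
    field_simp
    ring
  have h' : 0 ≤ δ * (|p| - δ⁻¹ * |q|) ^ 2 := by positivity
  linarith [abs_nonneg (p * q)]

namespace WeightedGraph

variable {V : Type*} (S : WeightedGraph V)

lemma mu_pos (x : V) : 0 < S.mu x := S.mumin_pos.trans_le (S.mu_ge x)

lemma w_nonneg (x y : V) : 0 ≤ S.w x y := by
  by_cases h : S.G.Adj x y
  · exact (S.w_pos x y h).le
  · exact (S.w_eq_zero x y h).ge

lemma tsum_w_mul (x : V) (g : V → ℝ) :
    ∑' y, S.w x y * g y = ∑ y ∈ (S.locallyFinite x).toFinset, S.w x y * g y := by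
  refine tsum_eq_sum fun y hy => ?_
  rw [S.w_eq_zero x y (by simpa using hy), zero_mul]

lemma lap_eq_sum (u : V → ℝ) (x : V) :
    S.lap u x = (1 / S.mu x) * ∑ y ∈ (S.locallyFinite x).toFinset, S.w x y * (u y - u x) := by
  rw [lap, S.tsum_w_mul x fun y => u y - u x]

lemma gradSq_eq_sum (u : V → ℝ) (x : V) :
    S.gradSq u x = (1 / (2 * S.mu x)) *
      ∑ y ∈ (S.locallyFinite x).toFinset, S.w x y * (u y - u x) ^ 2 := by
  rw [gradSq, S.tsum_w_mul x fun y => (u y - u x) ^ 2]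

lemma gradDot_eq_sum (u v : V → ℝ) (x : V) :
    S.gradDot u v x = (1 / (2 * S.mu x)) *
      ∑ y ∈ (S.locallyFinite x).toFinset, S.w x y * ((u y - u x) * (v y - v x)) := by
  simp only [gradDot, mul_assoc]
  rw [S.tsum_w_mul x fun y => (u y - u x) * (v y - v x)]

lemma gradSq_nonneg (u : V → ℝ) (x : V) : 0 ≤ S.gradSq u x := by
  rw [gradSq_eq_sum]
  have := S.mu_pos x
  have := Finset.sum_nonneg fun y (_ : y ∈ (S.locallyFinite x).toFinset) =>
    mul_nonneg (S.w_nonneg x y) (sq_nonneg (u y - u x))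
  positivity

lemma abs_gradDot_le {δ : ℝ} (hδ : 0 < δ) (u v : V → ℝ) (x : V) :
    |S.gradDot u v x| ≤ δ * S.gradSq u x + δ⁻¹ * S.gradSq v x := by
  have hmu := S.mu_pos x
  rw [gradDot_eq_sum, gradSq_eq_sum, gradSq_eq_sum, abs_mul,
    abs_of_pos (show 0 < 1 / (2 * S.mu x) by positivity), mul_left_comm δ, mul_left_comm δ⁻¹,
    ← mul_add]
  refine mul_le_mul_of_nonneg_left ?_ (by positivity)
  rw [Finset.mul_sum, Finset.mul_sum, ← Finset.sum_add_distrib]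
  refine (Finset.abs_sum_le_sum_abs _ _).trans (Finset.sum_le_sum fun y _ => ?_)
  rw [abs_mul, abs_of_nonneg (S.w_nonneg x y), mul_left_comm δ, mul_left_comm δ⁻¹, ← mul_add]
  exact mul_le_mul_of_nonneg_left (abs_mul_le_weighted_sq hδ _ _) (S.w_nonneg x y)

variable {a : ℝ} {Vp : V → ℝ}

lemma mul_sq_le_energyDensity (ha : 0 < a) (u : V → ℝ) (x : V) :
    Vp x * u x ^ 2 ≤ S.energyDensity a Vp u x := by
  have := mul_nonneg ha.le (S.gradSq_nonneg u x)
  rw [energyDensity]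
  linarith [sq_nonneg (S.lap u x)]

lemma energyDensity_nonneg (ha : 0 < a) (hV : ∀ x, 0 < Vp x) (u : V → ℝ) (x : V) :
    0 ≤ S.energyDensity a Vp u x :=
  (mul_nonneg (hV x).le (sq_nonneg _)).trans (S.mul_sq_le_energyDensity ha u x)

lemma abs_innerDensity_le (ha : 0 < a) (hV : ∀ x, 0 < Vp x) {δ : ℝ} (hδ : 0 < δ)
    (u v : V → ℝ) (x : V) :
    |S.lap u x * S.lap v x + a * S.gradDot u v x + Vp x * u x * v x| ≤
      δ * S.energyDensity a Vp u x + δ⁻¹ * S.energyDensity a Vp v x := by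
  have h1 := abs_mul_le_weighted_sq hδ (S.lap u x) (S.lap v x)
  have h2 := mul_le_mul_of_nonneg_left (S.abs_gradDot_le hδ u v x) ha.le
  have h3 := mul_le_mul_of_nonneg_left (abs_mul_le_weighted_sq hδ (u x) (v x)) (hV x).le
  refine (abs_add_three _ _ _).trans ?_
  rw [abs_mul a, abs_of_pos ha, mul_assoc (Vp x), abs_mul (Vp x), abs_of_pos (hV x)]
  simp only [energyDensity]
  linarith

variable {u : ℕ → V → ℝ} {v : V → ℝ}

lemma tendsto_lap (h : ∀ x, Tendsto (fun k => u k x) atTop (𝓝 (v x))) (x : V) :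
    Tendsto (fun k => S.lap (u k) x) atTop (𝓝 (S.lap v x)) := by
  simp only [lap_eq_sum]
  exact (tendsto_finsetSum _ fun y _ => ((h y).sub (h x)).const_mul _).const_mul _

lemma tendsto_gradSq (h : ∀ x, Tendsto (fun k => u k x) atTop (𝓝 (v x))) (x : V) :
    Tendsto (fun k => S.gradSq (u k) x) atTop (𝓝 (S.gradSq v x)) := by
  simp only [gradSq_eq_sum]
  exact (tendsto_finsetSum _ fun y _ => (((h y).sub (h x)).pow 2).const_mul _).const_mul _

lemma tendsto_gradDot (h : ∀ x, Tendsto (fun k => u k x) atTop (𝓝 (v x))) (w : V → ℝ) (x : V) :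
    Tendsto (fun k => S.gradDot (u k) w x) atTop (𝓝 (S.gradDot v w x)) := by
  simp only [gradDot_eq_sum]
  exact (tendsto_finsetSum _ fun y _ =>
    (((h y).sub (h x)).mul_const _).const_mul _).const_mul _

lemma tendsto_energyDensity (h : ∀ x, Tendsto (fun k => u k x) atTop (𝓝 (v x))) (x : V) :
    Tendsto (fun k => S.energyDensity a Vp (u k) x) atTop (𝓝 (S.energyDensity a Vp v x)) :=
  (((S.tendsto_lap h x).pow 2).add ((S.tendsto_gradSq h x).const_mul a)).add
    (((h x).pow 2).const_mul _)

lemma finite_walk_length (n : ℕ) (x₀ : V) :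
    {x | ∃ p : S.G.Walk x₀ x, p.length = n}.Finite := by
  induction n generalizing x₀ with
  | zero =>
    refine (Set.finite_singleton x₀).subset ?_
    rintro x ⟨p, hp⟩
    exact (SimpleGraph.Walk.eq_of_length_eq_zero hp).symm
  | succ n ih =>
    refine ((S.locallyFinite x₀).biUnion fun y _ => ih y).subset ?_
    rintro x ⟨p, hp⟩
    cases p with
    | nil => simp at hp
    | cons h p =>
      simp only [Set.mem_iUnion]
      exact ⟨_, h, p, by simpa using hp⟩

lemma finite_dist_lt (N : ℕ) (x₀ : V) : {x | S.G.dist x₀ x < N}.Finite := by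
  refine ((Set.finite_lt_nat N).biUnion fun n _ => S.finite_walk_length n x₀).subset ?_
  intro x hx
  obtain ⟨p, hp⟩ := S.connected.exists_walk_length_eq_dist x₀ x
  simp only [Set.mem_iUnion]
  exact ⟨_, hx, p, hp⟩

lemma countable (S : WeightedGraph V) : Countable V := by
  obtain ⟨x₀⟩ := S.connected.nonempty
  rw [← Set.countable_univ_iff]
  refine (Set.countable_iUnion fun N => (S.finite_dist_lt N x₀).countable).mono fun x _ => ?_
  exact Set.mem_iUnion.2 ⟨S.G.dist x₀ x + 1, Nat.lt_succ_self _⟩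

/-- A sequence that is bounded at each vertex has a pointwise convergent subsequence. -/
lemma exists_subseq_tendsto (S : WeightedGraph V) {B : V → ℝ} (hB : ∀ k x, |u k x| ≤ B x) :
    ∃ v : V → ℝ, ∃ ns : ℕ → ℕ, StrictMono ns ∧
      ∀ x, Tendsto (fun j => u (ns j) x) atTop (𝓝 (v x)) := by
  have := S.countable
  have hc : IsCompact (Set.univ.pi fun x => Set.Icc (-B x) (B x)) :=
    isCompact_univ_pi fun x => isCompact_Icc
  obtain ⟨v, -, ns, hns, hv⟩ := hc.tendsto_subseq fun k x _ => abs_le.1 (hB k x)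
  exact ⟨v, ns, hns, tendsto_pi_nhds.1 hv⟩

lemma sum_energyDensity_le_of_tendsto {C : ℝ}
    (hC : ∀ k, ∀ T : Finset V, ∑ x ∈ T, S.energyDensity a Vp (u k) x * S.mu x ≤ C)
    (h : ∀ x, Tendsto (fun k => u k x) atTop (𝓝 (v x))) (T : Finset V) :
    ∑ x ∈ T, S.energyDensity a Vp v x * S.mu x ≤ C :=
  le_of_tendsto (tendsto_finsetSum T fun x _ => (S.tendsto_energyDensity h x).mul_const _)
    (Eventually.of_forall fun k => hC k T)

lemma tendsto_innerE (ha : 0 < a) (hV : ∀ x, 0 < Vp x) {C : ℝ}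
    (hC : ∀ k, ∀ T : Finset V, ∑ x ∈ T, S.energyDensity a Vp (u k) x * S.mu x ≤ C)
    (h : ∀ x, Tendsto (fun k => u k x) atTop (𝓝 (v x))) {w : V → ℝ} (hw : S.memE a Vp w) :
    Tendsto (fun k => S.innerE a Vp (u k) w) atTop (𝓝 (S.innerE a Vp v w)) := by
  have hC0 : 0 ≤ C := by simpa using hC 0 ∅
  refine tendsto_tsum_of_uniform_tail (fun x => ?_) fun ε hε => ?_
  · exact ((((S.tendsto_lap h x).mul_const _).add ((S.tendsto_gradDot h w x).const_mul a)).add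
      (((h x).const_mul _).mul_const _)).mul_const _
  set δ : ℝ := ε / (2 * (C + 1)) with hδ_def
  have hδ : 0 < δ := by positivity
  have hδC : δ * C ≤ ε / 2 := by
    rw [hδ_def, div_mul_eq_mul_div, div_le_div_iff₀ (by positivity) two_pos]
    nlinarith
  obtain ⟨F, hF⟩ := summable_iff_vanishing_norm.1 hw (δ * (ε / 2)) (by positivity)
  refine ⟨F, fun k T hT => ?_⟩
  have hwT : δ⁻¹ * ∑ x ∈ T, S.energyDensity a Vp w x * S.mu x ≤ ε / 2 := by
    rw [inv_mul_le_iff₀ hδ]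
    exact (le_abs_self _).trans (hF T hT).le
  have huT := (mul_le_mul_of_nonneg_left (hC k T) hδ.le).trans hδC
  calc _ ≤ ∑ x ∈ T, (δ * (S.energyDensity a Vp (u k) x * S.mu x) +
        δ⁻¹ * (S.energyDensity a Vp w x * S.mu x)) := by
        refine (Finset.abs_sum_le_sum_abs _ _).trans (Finset.sum_le_sum fun x _ => ?_)
        rw [abs_mul, abs_of_pos (S.mu_pos x), ← mul_assoc, ← mul_assoc, ← add_mul]
        exact mul_le_mul_of_nonneg_right (S.abs_innerDensity_le ha hV hδ _ _ x) (S.mu_pos x).le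
    _ ≤ ε := by
        rw [Finset.sum_add_distrib, ← Finset.mul_sum, ← Finset.mul_sum]
        linarith

lemma sub_sq_mul_mu_le (ha : 0 < a) {M : ℝ} (hM : 0 < M) {x : V} (hx : M ≤ Vp x)
    (p q : V → ℝ) :
    (p x - q x) ^ 2 * S.mu x ≤ 2 / M * (S.energyDensity a Vp p x * S.mu x +
      S.energyDensity a Vp q x * S.mu x) := by
  have hle : ∀ f : V → ℝ, M * f x ^ 2 ≤ S.energyDensity a Vp f x := fun f =>
    (mul_le_mul_of_nonneg_right hx (sq_nonneg _)).trans (S.mul_sq_le_energyDensity ha f x)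
  rw [← add_mul, ← mul_assoc]
  refine mul_le_mul_of_nonneg_right ?_ (S.mu_pos x).le
  rw [div_mul_eq_mul_div, le_div_iff₀ hM]
  nlinarith [hle p, hle q, mul_nonneg hM.le (sq_nonneg (p x + q x))]

lemma summable_sub_sq (ha : 0 < a) {θ : ℝ} (hθ : 0 < θ) (hV : ∀ x, θ ≤ Vp x) {p q : V → ℝ}
    (hp : S.memE a Vp p) (hq : S.memE a Vp q) :
    Summable fun x => (p x - q x) ^ 2 * S.mu x :=
  Summable.of_nonneg_of_le (fun x => mul_nonneg (sq_nonneg _) (S.mu_pos x).le)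
    (fun x => S.sub_sq_mul_mu_le ha hθ (hV x) p q) ((hp.add hq).mul_left _)

lemma tendsto_integral_sub_sq (ha : 0 < a)
    (hVinf : ∃ x₀ : V, ∀ M : ℝ, ∃ N : ℕ, ∀ x : V, N ≤ S.G.dist x₀ x → M ≤ Vp x) {C : ℝ}
    (hC : ∀ k, ∀ T : Finset V, ∑ x ∈ T, S.energyDensity a Vp (u k) x * S.mu x ≤ C)
    (h : ∀ x, Tendsto (fun k => u k x) atTop (𝓝 (v x))) :
    Tendsto (fun k => S.integral fun x => (u k x - v x) ^ 2) atTop (𝓝 0) := by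
  have hC0 : 0 ≤ C := by simpa using hC 0 ∅
  rw [← tsum_zero (α := ℝ) (β := V)]
  refine tendsto_tsum_of_uniform_tail (fun x => ?_) fun ε hε => ?_
  · simpa using (((h x).sub_const (v x)).pow 2).mul_const (S.mu x)
  obtain ⟨x₀, hx₀⟩ := hVinf
  set M : ℝ := 4 * (C + 1) / ε with hM_def
  have hM : 0 < M := by positivity
  obtain ⟨N, hN⟩ := hx₀ M
  refine ⟨(S.finite_dist_lt N x₀).toFinset, fun k T hT => ?_⟩
  rw [abs_of_nonneg (Finset.sum_nonneg fun x _ => mul_nonneg (sq_nonneg _) (S.mu_pos x).le)]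
  calc _ ≤ ∑ x ∈ T, 2 / M * (S.energyDensity a Vp (u k) x * S.mu x +
        S.energyDensity a Vp v x * S.mu x) := by
        refine Finset.sum_le_sum fun x hx => S.sub_sq_mul_mu_le ha hM (hN x ?_) _ _
        simpa using Finset.disjoint_left.1 hT hx
    _ ≤ 2 / M * (C + C) := by
        rw [← Finset.mul_sum, Finset.sum_add_distrib]
        exact mul_le_mul_of_nonneg_left
          (add_le_add (hC k T) (S.sum_energyDensity_le_of_tendsto hC h T)) (by positivity)
    _ ≤ ε := by
        rw [div_mul_eq_mul_div, div_le_iff₀ hM, hM_def, mul_div_cancel₀ _ hε.ne']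
        linarith

lemma mumin_mul_sq_le_integral {f : V → ℝ} (hf : Summable fun x => f x ^ 2 * S.mu x) (x : V) :
    S.mumin * f x ^ 2 ≤ S.integral fun y => f y ^ 2 :=
  calc S.mumin * f x ^ 2 ≤ f x ^ 2 * S.mu x := by
        rw [mul_comm]
        exact mul_le_mul_of_nonneg_left (S.mu_ge x) (sq_nonneg _)
    _ ≤ _ := hf.le_tsum x fun y _ => mul_nonneg (sq_nonneg _) (S.mu_pos y).le

/-- Convergence to `0` in `L²` implies uniform convergence, as `μ` is bounded below. -/
lemma uniform_of_tendsto_integral_sq {f : ℕ → V → ℝ}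
    (hf : ∀ k, Summable fun x => f k x ^ 2 * S.mu x)
    (h : Tendsto (fun k => S.integral fun x => f k x ^ 2) atTop (𝓝 0)) {ε : ℝ} (hε : 0 < ε) :
    ∀ᶠ k in atTop, ∀ x, |f k x| ≤ ε := by
  have hpos : 0 < S.mumin * ε ^ 2 := mul_pos S.mumin_pos (by positivity)
  filter_upwards [h.eventually_lt_const hpos] with k hk x
  refine abs_le_of_sq_le_sq ?_ hε.le
  exact le_of_mul_le_mul_left ((S.mumin_mul_sq_le_integral (hf k) x).trans hk.le) S.mumin_pos

lemma tendsto_normLr_of_tendsto_integral_sq {f : ℕ → V → ℝ}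
    (hf : ∀ k, Summable fun x => f k x ^ 2 * S.mu x)
    (h : Tendsto (fun k => S.integral fun x => f k x ^ 2) atTop (𝓝 0)) {r : ℝ} (hr : 2 ≤ r) :
    Tendsto (fun k => S.normLr r (f k)) atTop (𝓝 0) := by
  have hnonneg : ∀ k x, 0 ≤ |f k x| ^ r * S.mu x := fun k x =>
    mul_nonneg (Real.rpow_nonneg (abs_nonneg _) _) (S.mu_pos x).le
  have hint : Tendsto (fun k => S.integral fun x => |f k x| ^ r) atTop (𝓝 0) := by
    refine squeeze_zero' (Eventually.of_forall fun k => tsum_nonneg (hnonneg k)) ?_ h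
    filter_upwards [S.uniform_of_tendsto_integral_sq hf h one_pos] with k hk
    have hle : ∀ x, |f k x| ^ r * S.mu x ≤ f k x ^ 2 * S.mu x := by
      intro x
      refine mul_le_mul_of_nonneg_right ?_ (S.mu_pos x).le
      rw [← sq_abs, ← Real.rpow_two]
      exact Real.rpow_le_rpow_of_exponent_ge_of_imp (abs_nonneg _) (hk x) hr
        fun _ h2 => absurd h2 (by positivity)
    exact Summable.tsum_le_tsum hle (Summable.of_nonneg_of_le (hnonneg k) hle (hf k)) (hf k)
  have hr' : 0 < 1 / r := by positivity
  simpa only [normLr, Real.zero_rpow hr'.ne'] using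
    hint.rpow_const (p := 1 / r) (Or.inr hr'.le)

end WeightedGraph

/-- Lemma 2.1 (compact embedding): under condition (V), every sequence bounded in `E_i`
has a subsequence converging weakly in `E_i`, pointwise on `V`, in every `L^r(V)` with
`2 ≤ r < ∞`, and uniformly on `V` (i.e. in `L^∞(V)`). -/
theorem compact_embedding
    {V : Type*} (S : WeightedGraph V)
    (a : ℝ) (ha : 0 < a) (Vp : V → ℝ) (θ : ℝ)
    (hglb : IsGLB (Set.range Vp) θ) (hθ : 0 < θ)
    (hVinf : ∃ x₀ : V, ∀ M : ℝ, ∃ N : ℕ, ∀ x : V, N ≤ S.G.dist x₀ x → M ≤ Vp x)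
    (u : ℕ → V → ℝ) (humem : ∀ k, S.memE a Vp (u k))
    (hbdd : ∃ C : ℝ, ∀ k, S.normE a Vp (u k) ≤ C) :
    ∃ ns : ℕ → ℕ, StrictMono ns ∧ ∃ ulim : V → ℝ, S.memE a Vp ulim ∧
      (∀ w : V → ℝ, S.memE a Vp w →
        Tendsto (fun j => S.innerE a Vp (u (ns j)) w) atTop (nhds (S.innerE a Vp ulim w))) ∧
      (∀ x : V, Tendsto (fun j => u (ns j) x) atTop (nhds (ulim x))) ∧
      (∀ r : ℝ, 2 ≤ r →
        Tendsto (fun j => S.normLr r (fun x => u (ns j) x - ulim x)) atTop (nhds 0)) ∧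
      (∀ ε : ℝ, 0 < ε → ∃ N : ℕ, ∀ j, N ≤ j → ∀ x : V, |u (ns j) x - ulim x| ≤ ε) := by
  have hVθ : ∀ x, θ ≤ Vp x := fun x => hglb.1 ⟨x, rfl⟩
  have hV : ∀ x, 0 < Vp x := fun x => hθ.trans_le (hVθ x)
  obtain ⟨C, hC⟩ := hbdd
  have hnonneg : ∀ f x, 0 ≤ S.energyDensity a Vp f x * S.mu x := fun f x =>
    mul_nonneg (S.energyDensity_nonneg ha hV f x) (S.mu_pos x).le
  have hsum : ∀ k, ∀ T : Finset V,
      ∑ x ∈ T, S.energyDensity a Vp (u k) x * S.mu x ≤ C ^ 2 := fun k T =>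
    ((humem k).sum_le_tsum T fun x _ => hnonneg _ x).trans (Real.sqrt_le_iff.1 (hC k)).2
  have hptwise : ∀ k x, |u k x| ≤ √(C ^ 2 / (Vp x * S.mu x)) := by
    intro k x
    refine Real.abs_le_sqrt ?_
    rw [le_div_iff₀ (mul_pos (hV x) (S.mu_pos x))]
    have h := mul_le_mul_of_nonneg_right (S.mul_sq_le_energyDensity (Vp := Vp) ha (u k) x)
      (S.mu_pos x).le
    have h' := hsum k {x}
    rw [Finset.sum_singleton] at h'
    linarith
  obtain ⟨v, ns, hns, hv⟩ := S.exists_subseq_tendsto hptwise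
  have hsum' := fun j => hsum (ns j)
  have hvmem : S.memE a Vp v := summable_of_sum_le (hnonneg v)
    (S.sum_energyDensity_le_of_tendsto hsum' hv)
  have hL2 := S.tendsto_integral_sub_sq ha hVinf hsum' hv
  have hL2s := fun j => S.summable_sub_sq ha hθ hVθ (humem (ns j)) hvmem
  exact ⟨ns, hns, v, hvmem, fun w hw => S.tendsto_innerE ha hV hsum' hv hw, hv,
    fun r hr => S.tendsto_normLr_of_tendsto_integral_sq hL2s hL2 hr,
    fun ε hε => eventually_atTop.1 (S.uniform_of_tendsto_integral_sq hL2s hL2 hε)⟩
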